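/- If κ is a weakly shrewd cardinal, then κ is a weakly Mahlo cardinal, i.e., κ is regular and the set of regular cardinals below κ is stationary in κ. -/

import Mathlib

universe u

open Cardinal

/-- Formulas of the language of set theory with an additional unary predicate
symbol `pred`; variables are indexed by natural numbers. -/
inductive SF : Type
  | mem : ℕ → ℕ → SF
  | eq : ℕ → ℕ → SF
  | pred : ℕ → SF
  | not : SF → SF
  | and : SF → SF → SF
  | ex : ℕ → SF → SF

/-- The free variables of a formula. -/
def SF.fv : SF → Set ℕ
  | .mem i j => {i, j}
  | .eq i j => {i, j}
  | .pred i => {i}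
  | .not φ => φ.fv
  | .and φ ψ => φ.fv ∪ ψ.fv
  | .ex k φ => φ.fv \ {k}

/-- Tarskian satisfaction of a formula in the structure whose carrier is the
class `S`, where the membership symbol is interpreted by the binary relation `E`
and the extra unary predicate symbol by the class `P`, under the valuation `v`. -/
def Sat (P : Set ZFSet.{u}) (E : ZFSet.{u} → ZFSet.{u} → Prop) (S : Set ZFSet.{u}) :
    SF → (ℕ → ZFSet.{u}) → Prop
  | .mem i j, v => E (v i) (v j)
  | .eq i j, v => v i = v j
  | .pred i, v => v i ∈ P
  | .not φ, v => ¬ Sat P E S φ v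
  | .and φ ψ, v => Sat P E S φ v ∧ Sat P E S ψ v
  | .ex k φ, v => ∃ x, x ∈ S ∧ Sat P E S φ (Function.update v k x)

/-- Satisfaction in the `∈`-structure with carrier `S`, the predicate symbol
being interpreted by the class `R`. -/
def SatIn (R : Set ZFSet.{u}) (S : Set ZFSet.{u}) (φ : SF) (v : ℕ → ZFSet.{u}) : Prop :=
  Sat R (· ∈ ·) S φ v

/-- Δ₀-formulas: built from atomic formulas by propositional connectives and
bounded existential quantification. -/
inductive IsDeltaZero : SF → Prop
  | mem (i j) : IsDeltaZero (.mem i j)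
  | eq (i j) : IsDeltaZero (.eq i j)
  | pred (i) : IsDeltaZero (.pred i)
  | not {φ} : IsDeltaZero φ → IsDeltaZero (.not φ)
  | and {φ ψ} : IsDeltaZero φ → IsDeltaZero ψ → IsDeltaZero (.and φ ψ)
  | bex {φ} (k j) : IsDeltaZero φ → IsDeltaZero (.ex k (.and (.mem k j) φ))

mutual
  /-- Σₙ-formulas of the Lévy hierarchy. -/
  inductive IsSigma : ℕ → SF → Prop
    | of_zero {φ} : IsDeltaZero φ → IsSigma 0 φ
    | of_pi {n φ} : IsPi n φ → IsSigma (n + 1) φ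
    | ex {n φ} (k) : IsSigma (n + 1) φ → IsSigma (n + 1) (.ex k φ)
  /-- Πₙ-formulas of the Lévy hierarchy. -/
  inductive IsPi : ℕ → SF → Prop
    | of_zero {φ} : IsDeltaZero φ → IsPi 0 φ
    | not {n φ} : IsSigma (n + 1) φ → IsPi (n + 1) (.not φ)
end

/-- The valuation sending `v₀` to `a`, `v₁` to `b` and all other variables to `∅`. -/
def val2 (a b : ZFSet.{u}) : ℕ → ZFSet.{u} := fun i => if i = 0 then a else if i = 1 then b else ∅

/-- `x` is a (von Neumann) ordinal. -/
def ZOrd (x : ZFSet.{u}) : Prop := x.IsTransitive ∧ ∀ y ∈ x, ZFSet.IsTransitive y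

/-- `κ` is a (von Neumann) cardinal. -/
def ZCard (κ : ZFSet.{u}) : Prop := ZOrd κ ∧ ∀ β ∈ κ, #β.toSet < #κ.toSet

/-- `κ` is an infinite cardinal. -/
def InfCard (κ : ZFSet.{u}) : Prop := ZCard κ ∧ ZFSet.omega ⊆ κ

/-- `κ` is an infinite regular cardinal: every cofinal subset of `κ` has
cardinality `κ`. -/
def ZRegular (κ : ZFSet.{u}) : Prop :=
  InfCard κ ∧ ∀ x : ZFSet.{u}, x ⊆ κ →
    (∀ β ∈ κ, ∃ γ ∈ x, β ∈ γ ∨ β = γ) → #x.toSet = #κ.toSet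

/-- `C` is a closed unbounded (class of) subset(s) of the ordinal `κ`. -/
def ZClub (C : Set ZFSet.{u}) (κ : ZFSet.{u}) : Prop :=
  (∀ γ ∈ C, γ ∈ κ) ∧ (∀ β ∈ κ, ∃ γ ∈ C, β ∈ γ) ∧
    (∀ β ∈ κ, (∃ γ, γ ∈ β) → (∀ γ ∈ β, ∃ δ ∈ C, γ ∈ δ ∧ δ ∈ β) → β ∈ C)

/-- `S` is stationary in `κ`: it meets every closed unbounded subset of `κ`. -/
def ZStationary (S : Set ZFSet.{u}) (κ : ZFSet.{u}) : Prop :=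
  ∀ C, ZClub C κ → ∃ γ ∈ C, γ ∈ S

/-- `H(θ)`: the class of all sets hereditarily of cardinality less than `θ`. -/
def HSet (θ : ZFSet.{u}) : Set ZFSet.{u} :=
  {x | ∃ t : ZFSet.{u}, t.IsTransitive ∧ x ⊆ t ∧ #t.toSet < #θ.toSet}

/-- `θ` is the cardinal successor `κ⁺` of `κ`. -/
def SuccCardOf (θ κ : ZFSet.{u}) : Prop :=
  ZCard θ ∧ κ ∈ θ ∧ ∀ μ, ZCard μ → κ ∈ μ → θ ⊆ μ

/-- `κ` is a weakly shrewd cardinal. -/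
def WeaklyShrewd (κ : ZFSet.{u}) : Prop :=
  InfCard κ ∧
    ∀ (φ : SF) (θ A : ZFSet.{u}), φ.fv ⊆ {0, 1} → ZCard θ → κ ∈ θ → A ⊆ κ →
      SatIn ∅ (HSet θ) φ (val2 A κ) →
      ∃ κ' θ' : ZFSet.{u}, ZCard κ' ∧ ZCard θ' ∧ κ' ∈ θ' ∧ κ' ∈ κ ∧
        SatIn ∅ (HSet θ') φ (val2 (A ∩ κ') κ')

/-- `j` is an elementary embedding of the `∈`-structure (with predicate `R`)
with carrier `X` into the one with carrier `Y`. -/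
def ElemEmbOn (R : Set ZFSet.{u}) (X Y : Set ZFSet.{u}) (j : ZFSet.{u} → ZFSet.{u}) : Prop :=
  (∀ x ∈ X, j x ∈ Y) ∧
    ∀ (φ : SF) (v : ℕ → ZFSet.{u}), (∀ i, v i ∈ X) →
      (SatIn R X φ v ↔ SatIn R Y φ (fun i => j (v i)))

/-- `X` is an elementary submodel of `Y` (as `∈`-structures with predicate `R`). -/
def ElemSub (R : Set ZFSet.{u}) (X Y : Set ZFSet.{u}) : Prop :=
  X ⊆ Y ∧ ∀ (φ : SF) (v : ℕ → ZFSet.{u}), (∀ i, v i ∈ X) → (SatIn R X φ v ↔ SatIn R Y φ v)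

/-- `X` is a Σₙ-elementary submodel of `Y`. -/
def SigmaElemSub (R : Set ZFSet.{u}) (n : ℕ) (X Y : Set ZFSet.{u}) : Prop :=
  X ⊆ Y ∧ ∀ (φ : SF), IsSigma n φ → ∀ (v : ℕ → ZFSet.{u}), (∀ i, v i ∈ X) →
    (SatIn R X φ v ↔ SatIn R Y φ v)

namespace SF
def imp (φ ψ : SF) : SF := .not (.and φ (.not ψ))
def all (k : ℕ) (φ : SF) : SF := .not (.ex k (.not φ))
/-- Some element of `f` contains both `a` and `b`. -/
def linked (a b f : ℕ) : SF := .ex 13 (.and (.mem 13 f) (.and (.mem a 13) (.mem b 13)))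
/-- `f` codes an injection of `x` into `y`. -/
def inj (x y f : ℕ) : SF :=
  .and (all 10 (imp (.mem 10 x) (.ex 11 (.and (.mem 11 y) (linked 10 11 f)))))
    (all 11 (imp (.mem 11 y) (all 10 (imp (.mem 10 x) (all 12 (imp (.mem 12 x)
      (imp (linked 10 11 f) (imp (linked 12 11 f) (.eq 10 12)))))))))
def phi1 : SF := .ex 2 (.and (.mem 2 0) (.ex 3 (inj 2 0 3)))
def phi2 : SF :=
  .and (.ex 2 (.mem 2 1)) (.and
    (all 2 (imp (.mem 2 1) (.ex 3 (.and (.mem 3 0) (.and (.mem 3 1) (.mem 2 3))))))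
    (all 2 (imp (all 3 (imp (.mem 3 2) (.mem 3 1))) (all 4 (imp (.mem 4 1) (all 5 (imp (inj 2 4 5)
      (.ex 6 (.and (.mem 6 1) (all 7 (imp (.mem 7 2)
        (.and (.not (.mem 6 7)) (.not (.eq 6 7))))))))))))))
theorem fv1 : phi1.fv ⊆ {0, 1} := by
  intro n
  simp only [phi1, inj, linked, all, imp, SF.fv, Set.mem_sdiff, Set.mem_union, Set.mem_insert_iff,
    Set.mem_singleton_iff]
  omega
theorem fv2 : phi2.fv ⊆ {0, 1} := by
  intro n
  simp only [phi2, inj, linked, all, imp, SF.fv, Set.mem_sdiff, Set.mem_union, Set.mem_insert_iff,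
    Set.mem_singleton_iff]
  omega
end SF

/-- semantic version of `SF.inj` -/
def LinkedIn (a b f : ZFSet.{u}) : Prop := ∃ p ∈ f, a ∈ p ∧ b ∈ p
def InjCode (x y f : ZFSet.{u}) : Prop :=
  (∀ a ∈ x, ∃ b ∈ y, LinkedIn a b f) ∧
    ∀ b ∈ y, ∀ a ∈ x, ∀ a' ∈ x, LinkedIn a b f → LinkedIn a' b f → a = a'

theorem sat_imp {S : Set ZFSet.{u}} {φ ψ : SF} {v} :
    SatIn ∅ S (.imp φ ψ) v ↔ (SatIn ∅ S φ v → SatIn ∅ S ψ v) := by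
  simp [SF.imp, SatIn, Sat]
theorem sat_all {S : Set ZFSet.{u}} {k : ℕ} {φ : SF} {v} :
    SatIn ∅ S (.all k φ) v ↔ ∀ x ∈ S, SatIn ∅ S φ (Function.update v k x) := by
  simp [SF.all, SatIn, Sat]
theorem sat_ex {S : Set ZFSet.{u}} {k : ℕ} {φ : SF} {v} :
    SatIn ∅ S (.ex k φ) v ↔ ∃ x ∈ S, SatIn ∅ S φ (Function.update v k x) := by
  simp [SatIn, Sat]
theorem sat_and {S : Set ZFSet.{u}} {φ ψ : SF} {v} :
    SatIn ∅ S (.and φ ψ) v ↔ (SatIn ∅ S φ v ∧ SatIn ∅ S ψ v) := by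
  simp [SatIn, Sat]
theorem sat_not {S : Set ZFSet.{u}} {φ : SF} {v} :
    SatIn ∅ S (.not φ) v ↔ ¬ SatIn ∅ S φ v := by
  simp [SatIn, Sat]
theorem sat_mem {S : Set ZFSet.{u}} {i j : ℕ} {v} :
    SatIn ∅ S (.mem i j) v ↔ v i ∈ v j := by
  simp [SatIn, Sat]
theorem sat_eq {S : Set ZFSet.{u}} {i j : ℕ} {v} :
    SatIn ∅ S (.eq i j) v ↔ v i = v j := by
  simp [SatIn, Sat]

theorem sat_linked {S : Set ZFSet.{u}} (hS : ∀ x ∈ S, ∀ y ∈ x, y ∈ S) {a b f : ℕ} {v}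
    (ha : a < 13) (hb : b < 13) (hf : f < 13) (hfS : v f ∈ S) :
    SatIn ∅ S (.linked a b f) v ↔ LinkedIn (v a) (v b) (v f) := by
  simp only [SF.linked, sat_ex, sat_and, sat_mem, Function.update_self,
    Function.update_of_ne ha.ne, Function.update_of_ne hb.ne, Function.update_of_ne hf.ne, LinkedIn]
  constructor
  · rintro ⟨p, -, h⟩; exact ⟨p, h⟩
  · rintro ⟨p, h⟩; exact ⟨p, hS _ hfS _ h.1, h⟩

theorem sat_inj {S : Set ZFSet.{u}} (hS : ∀ x ∈ S, ∀ y ∈ x, y ∈ S) {x y f : ℕ} {v}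
    (hx : x < 10) (hy : y < 10) (hf : f < 10) (hxS : v x ∈ S) (hyS : v y ∈ S) (hfS : v f ∈ S) :
    SatIn ∅ S (.inj x y f) v ↔ InjCode (v x) (v y) (v f) := by
  have e : ∀ {i j : ℕ} {w : ℕ → ZFSet.{u}} {z}, i < 10 → 10 ≤ j →
    Function.update w j z i = w i := fun h1 h2 => Function.update_of_ne (by omega) _ _
  simp only [SF.inj, sat_ex, sat_and, sat_all, sat_imp]
  have hl : ∀ (w : ℕ → ZFSet.{u}) a b, a < 13 → b < 13 → w f = v f →
      (SatIn ∅ S (.linked a b f) w ↔ LinkedIn (w a) (w b) (v f)) := by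
    intro w a b ha hb hw
    rw [sat_linked hS ha hb (by omega) (hw ▸ hfS), hw]
  have h1 : ∀ a b : ZFSet.{u}, (SatIn ∅ S (.linked 10 11 f)
      (Function.update (Function.update v 10 a) 11 b) ↔ LinkedIn a b (v f)) := by
    intro a b
    rw [hl _ _ _ (by norm_num) (by norm_num) (by simp [e, hf])]
    simp [Function.update]
  have h2 : ∀ a b c : ZFSet.{u}, (SatIn ∅ S (.linked 10 11 f)
      (Function.update (Function.update (Function.update v 11 b) 10 a) 12 c) ↔
        LinkedIn a b (v f)) := by
    intro a b c
    rw [hl _ _ _ (by norm_num) (by norm_num) (by simp [e, hf])]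
    simp [Function.update]
  have h3 : ∀ a b c : ZFSet.{u}, (SatIn ∅ S (.linked 12 11 f)
      (Function.update (Function.update (Function.update v 11 b) 10 a) 12 c) ↔
        LinkedIn c b (v f)) := by
    intro a b c
    rw [hl _ _ _ (by norm_num) (by norm_num) (by simp [e, hf])]
    simp [Function.update]
  simp only [h1, h2, h3, sat_mem, sat_eq, e hx (le_refl 10), e hx (show 10 ≤ 12 by norm_num),
    e hx (show 10 ≤ 11 by norm_num), e hy (le_refl 10), e hy (show 10 ≤ 11 by norm_num),
    Function.update_self, InjCode]
  constructor
  · rintro ⟨h, h'⟩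
    refine ⟨fun a ha => ?_, fun b hb a ha a' ha' => ?_⟩
    · obtain ⟨b, -, hb⟩ := h a (hS _ hxS _ ha) ha
      exact ⟨b, hb⟩
    · simpa [Function.update] using
        h' b (hS _ hyS _ hb) hb a (hS _ hxS _ ha) ha a' (hS _ hxS _ ha') ha'
  · rintro ⟨h, h'⟩
    refine ⟨fun a _ ha => ?_, fun b _ hb a _ ha a' _ ha' => ?_⟩
    · obtain ⟨b, hb⟩ := h a ha
      exact ⟨b, hS _ hyS _ hb.1, hb⟩
    · simpa [Function.update] using h' b hb a ha a' ha'

theorem sat_phi1 {S : Set ZFSet.{u}} (hS : ∀ x ∈ S, ∀ y ∈ x, y ∈ S) {A κ : ZFSet.{u}} (hA : A ∈ S) :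
    SatIn ∅ S .phi1 (val2 A κ) ↔ ∃ l ∈ A, ∃ f ∈ S, InjCode l A f := by
  have key : ∀ l ∈ S, ∀ f ∈ S, (SatIn ∅ S (.inj 2 0 3)
      (Function.update (Function.update (val2 A κ) 2 l) 3 f) ↔ InjCode l A f) := by
    intro l hl f hf
    rw [sat_inj hS (by norm_num) (by norm_num) (by norm_num)] <;>
      simp [Function.update, val2, hl, hf, hA]
  simp only [SF.phi1, sat_ex, sat_and, sat_mem]
  constructor
  · rintro ⟨l, hl, hlA, f, hf, h⟩
    exact ⟨l, by simpa [Function.update, val2] using hlA, f, hf, (key l hl f hf).1 h⟩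
  · rintro ⟨l, hlA, f, hf, h⟩
    have hl := hS _ hA _ hlA
    exact ⟨l, hl, by simpa [Function.update, val2] using hlA, f, hf, (key l hl f hf).2 h⟩

theorem sat_phi2 {S : Set ZFSet.{u}} (hS : ∀ x ∈ S, ∀ y ∈ x, y ∈ S) {A κ : ZFSet.{u}}
    (hκ : κ ∈ S) :
    SatIn ∅ S .phi2 (val2 A κ) ↔ (∃ x, x ∈ κ) ∧ (∀ x ∈ κ, ∃ y ∈ A, y ∈ κ ∧ x ∈ y) ∧
      ∀ x ∈ S, x ⊆ κ → ∀ β ∈ κ, ∀ f ∈ S, InjCode x β f → ∃ γ ∈ κ, ∀ a ∈ x, γ ∉ a ∧ γ ≠ a := by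
  have key : ∀ x ∈ S, ∀ β ∈ S, ∀ f ∈ S, (SatIn ∅ S (.inj 2 4 5)
      (Function.update (Function.update (Function.update (val2 A κ) 2 x) 4 β) 5 f) ↔
        InjCode x β f) := by
    intro l hl β hβ f hf
    rw [sat_inj hS (by norm_num) (by norm_num) (by norm_num)] <;>
      simp [Function.update, hl, hf, hβ]
  simp only [SF.phi2, sat_ex, sat_and, sat_mem, sat_all, sat_imp, sat_not, sat_eq]
  refine and_congr ?_ (and_congr ?_ ?_)
  · simp only [Function.update, val2]
    simp
    exact ⟨fun ⟨x, h⟩ => ⟨x, h.2⟩, fun ⟨x, h⟩ => ⟨x, hS _ hκ _ h, h⟩⟩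
  · simp only [Function.update, val2]
    simp
    constructor
    · intro h x hx
      obtain ⟨y, hy⟩ := h x (hS _ hκ _ hx) hx
      exact ⟨y, hy.2⟩
    · intro h x _ hx
      obtain ⟨y, hy⟩ := h x hx
      exact ⟨y, hS _ hκ _ hy.2.1, hy⟩
  · constructor
    · intro h x hx hxκ β hβ f hf hi
      have h1 := h x hx (by intro y _; simpa [Function.update, val2] using @hxκ y) β
        (hS _ hκ _ hβ) (by simpa [Function.update, val2] using hβ) f hf
        ((key x hx β (hS _ hκ _ hβ) f hf).2 hi)
      simp only [Function.update, val2] at h1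
      simp at h1
      obtain ⟨γ, -, hγ, h1⟩ := h1
      exact ⟨γ, hγ, fun a ha => h1 a (hS _ hx _ ha) ha⟩
    · intro h x hx hxκ β hβS hβ f hf hi
      have hβ' : β ∈ κ := by simpa [Function.update, val2] using hβ
      obtain ⟨γ, hγ, h1⟩ := h x hx (by
        intro y hy; simpa [Function.update, val2, hy] using hxκ y (hS _ hx _ hy)) β hβ' f hf
          ((key x hx β hβS f hf).1 hi)
      refine ⟨γ, hS _ hκ _ hγ, ?_⟩
      simp only [Function.update, val2]
      simp
      exact ⟨hγ, fun a _ ha => h1 a ha⟩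

theorem HSet_trans {θ : ZFSet.{u}} : ∀ x ∈ HSet θ, ∀ y ∈ x, y ∈ HSet θ := by
  rintro x ⟨t, ht, hx, hc⟩ y hy
  exact ⟨t, ht, ht _ (hx hy), hc⟩

theorem mk_toSet (x : ZFSet.{u}) : #x.toSet = Cardinal.lift.{u+1} x.card :=
  ZFSet.cardinalMk_coe_sort

theorem HSet_iff {θ x : ZFSet.{u}} :
    x ∈ HSet θ ↔ ∃ t : ZFSet.{u}, t.IsTransitive ∧ x ⊆ t ∧ t.card < θ.card := by
  simp [HSet, mk_toSet]

theorem InjCode.card_le {x y f : ZFSet.{u}} (h : InjCode x y f) : x.card ≤ y.card := by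
  obtain ⟨h1, h2⟩ := h
  choose! F hF hF' using h1
  have : #x ≤ #y := by
    refine Cardinal.mk_le_of_injective (f := fun a : x => (⟨F a, hF a a.2⟩ : y)) ?_
    rintro ⟨a, ha⟩ ⟨b, hb⟩ hab
    have hab : F a = F b := congrArg Subtype.val hab
    exact Subtype.ext (h2 (F a) (hF a ha) a ha b hb (hF' a ha) (hab ▸ hF' b hb))
  simpa [ZFSet.cardinalMk_coe_sort] using this

theorem exists_injCode {x y κ : ZFSet.{u}} (hd : ∀ a ∈ x, a ∉ y) (h : x.card ≤ y.card)
    (hx : x ⊆ κ) (hy : y ⊆ κ) (hκ : κ.IsTransitive) (hinf : ℵ₀ ≤ κ.card) {θ : ZFSet.{u}}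
    (hθ : κ.card < θ.card) : ∃ f ∈ HSet θ, InjCode x y f := by
  have h' : #x ≤ #y := by simpa [ZFSet.cardinalMk_coe_sort] using h
  obtain ⟨F⟩ := h'
  refine ⟨ZFSet.range (fun a : x => ({a.1, (F a).1} : ZFSet.{u})), ?_, ?_⟩
  · rw [HSet_iff]
    refine ⟨κ ∪ ZFSet.range (fun a : x => ({a.1, (F a).1} : ZFSet.{u})), ?_, ?_, ?_⟩
    · intro z hz
      rcases ZFSet.mem_union.1 hz with hz | hz
      · exact fun w hw => ZFSet.mem_union.2 (Or.inl (hκ z hz hw))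
      · obtain ⟨a, rfl⟩ := ZFSet.mem_range.1 hz
        intro w hw
        rcases ZFSet.mem_pair.1 hw with rfl | rfl
        · exact ZFSet.mem_union.2 (Or.inl (hx a.2))
        · exact ZFSet.mem_union.2 (Or.inl (hy (F a).2))
    · exact fun w hw => ZFSet.mem_union.2 (Or.inr hw)
    · refine lt_of_le_of_lt ZFSet.card_union_le ?_
      have : (ZFSet.range (fun a : x => ({a.1, (F a).1} : ZFSet.{u}))).card ≤ κ.card := by
        have := ZFSet.lift_card_range_le (f := (fun a : x => ({a.1, (F a).1} : ZFSet.{u})))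
        rw [ZFSet.cardinalMk_coe_sort] at this
        simp at this
        exact this.trans (ZFSet.card_mono hx)
      exact lt_of_le_of_lt (Cardinal.add_le_of_le hinf le_rfl this) hθ
  · have link : ∀ a ∈ x, ∀ b ∈ y,
        LinkedIn a b (ZFSet.range (fun a : x => ({a.1, (F a).1} : ZFSet.{u}))) →
        ∃ h : a ∈ x, (F ⟨a, h⟩).1 = b := by
      rintro a ha b hb ⟨p, hp, hap, hbp⟩
      obtain ⟨c, rfl⟩ := ZFSet.mem_range.1 hp
      rcases ZFSet.mem_pair.1 hap with rfl | rfl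
      · rcases ZFSet.mem_pair.1 hbp with rfl | rfl
        · exact absurd hb (hd _ ha)
        · exact ⟨ha, rfl⟩
      · exact absurd (F c).2 (hd _ ha)
    refine ⟨fun a ha => ⟨(F ⟨a, ha⟩).1, (F ⟨a, ha⟩).2, _, ZFSet.mem_range.2 ⟨⟨a, ha⟩, rfl⟩,
      by simp, by simp⟩, ?_⟩
    intro b hb a ha a' ha' h1 h2
    obtain ⟨_, h1⟩ := link a ha b hb h1
    obtain ⟨_, h2⟩ := link a' ha' b hb h2
    simpa using F.injective (Subtype.ext (h1.trans h2.symm))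

open Ordinal in
theorem mem_omega_iff {x : ZFSet.{u}} :
    x ∈ ZFSet.omega.{u} ↔ ∃ n : ℕ, x = Ordinal.toZFSet (n : Ordinal.{u}) := by
  have key : ∀ n : ℕ, ZFSet.mk (PSet.ofNat n) = Ordinal.toZFSet (n : Ordinal.{u}) := by
    intro n
    induction n with
    | zero => rw [Nat.cast_zero, Ordinal.toZFSet_zero]; rfl
    | succ n ih =>
      rw [Nat.cast_succ, toZFSet_add_one, ← ih]
      rfl
  constructor
  · refine Quotient.inductionOn x ?_
    rintro x ⟨⟨n⟩, h⟩
    exact ⟨n, by rw [← key n]; exact ZFSet.sound h⟩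
  · rintro ⟨n, rfl⟩
    rw [← key]
    exact ⟨⟨n⟩, PSet.Equiv.rfl⟩

theorem ZCard_iff {κ : ZFSet.{u}} :
    ZCard κ ↔ ∃ c : Cardinal.{u}, κ = c.ord.toZFSet := by
  unfold ZCard ZOrd
  rw [← ZFSet.isOrdinal_iff_forall_mem_isTransitive]
  constructor
  · rintro ⟨h, h2⟩
    obtain ⟨o, rfl⟩ := ZFSet.isOrdinal_iff_mem_range_toZFSet.1 h
    refine ⟨o.card, ?_⟩
    congr 1
    refine le_antisymm ?_ (Cardinal.ord_card_le o)
    by_contra! hlt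
    have := h2 _ (Ordinal.toZFSet_mem_toZFSet_iff.2 hlt)
    simp [mk_toSet] at this
  · rintro ⟨c, rfl⟩
    refine ⟨ZFSet.isOrdinal_toZFSet _, fun β hβ => ?_⟩
    obtain ⟨a, ha, rfl⟩ := Ordinal.mem_toZFSet_iff.1 hβ
    rw [mk_toSet, mk_toSet, Cardinal.lift_lt]
    simpa using Cardinal.lt_ord.1 ha

theorem InfCard_iff {κ : ZFSet.{u}} :
    InfCard κ ↔ ∃ c : Cardinal.{u}, ℵ₀ ≤ c ∧ κ = c.ord.toZFSet := by
  unfold InfCard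
  rw [ZCard_iff]
  constructor
  · rintro ⟨⟨c, rfl⟩, h⟩
    refine ⟨c, ?_, rfl⟩
    rw [Cardinal.aleph0_le]
    intro n
    have := h (mem_omega_iff.2 ⟨n, rfl⟩)
    rw [Ordinal.toZFSet_mem_toZFSet_iff, Cardinal.lt_ord] at this
    simpa using this.le
  · rintro ⟨c, hc, rfl⟩
    refine ⟨⟨c, rfl⟩, fun x hx => ?_⟩
    obtain ⟨n, rfl⟩ := mem_omega_iff.1 hx
    rw [Ordinal.toZFSet_mem_toZFSet_iff, Cardinal.lt_ord]
    simpa using (Cardinal.natCast_lt_aleph0 (n := n)).trans_le hc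

theorem exists_cof_set {o : Ordinal.{u}} (ho : Order.IsSuccLimit o) (hcof : o.cof.ord < o) :
    ∃ A : Set Ordinal.{u}, A ⊆ Set.Iio o ∧ o.cof.ord ∈ A ∧ (∀ a ∈ A, o.cof.ord ≤ a) ∧
      Cardinal.lift.{u+1} o.cof ≤ #A ∧
      ∀ α < o, #(A ∩ Set.Iio α : Set Ordinal.{u}) < Cardinal.lift.{u+1} o.cof := by
  have hinf : ℵ₀ ≤ o.cof := Ordinal.aleph0_le_cof_iff.2 (Ordinal.one_lt_cof_iff.2 ho)
  have hc : Order.cof (Set.Iio o) = Cardinal.lift.{u+1} o.cof := by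
    rw [Ordinal.cof_Iio, Ordinal.lift_cof]
  obtain ⟨s, hs, hst⟩ := Ordinal.exists_ord_cof_eq (Set.Iio o)
  rw [hc] at hst
  refine ⟨insert o.cof.ord (Subtype.val '' {a : Set.Iio o | a ∈ s ∧ o.cof.ord ≤ a.1}),
    ?_, Set.mem_insert _ _, ?_, ?_, ?_⟩
  · rintro a (rfl | ⟨b, -, rfl⟩)
    · exact hcof
    · exact b.2
  · rintro a (rfl | ⟨b, hb, rfl⟩)
    · exact le_rfl
    · exact hb.2
  · refine le_trans ?_ (Cardinal.mk_le_mk_of_subset (Set.subset_insert _ _))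
    rw [Cardinal.mk_image_eq Subtype.val_injective, ← hc]
    refine Order.cof_le ?_
    intro a
    obtain ⟨b, hb, hab⟩ := hs (max a ⟨_, hcof⟩)
    exact ⟨b, ⟨hb, (max_le_iff.1 hab).2⟩, (max_le_iff.1 hab).1⟩
  · intro α hα
    obtain ⟨b, hb, hab⟩ := hs ⟨α, hα⟩
    have h1 : #{y : s // y < ⟨b, hb⟩} < Cardinal.lift.{u+1} o.cof := by
      have := Ordinal.typein_lt_type (α := s) (· < ·) ⟨b, hb⟩
      rw [hst, Cardinal.lt_ord] at this
      exact this
    have h2 : (insert o.cof.ord (Subtype.val '' {a : Set.Iio o | a ∈ s ∧ o.cof.ord ≤ a.1}) ∩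
        Set.Iio α : Set Ordinal.{u}) ⊆
          insert o.cof.ord (Set.range fun y : {y : s // y < ⟨b, hb⟩} => y.1.1.1) := by
      rintro a ⟨rfl | ⟨c, hc, rfl⟩, ha⟩
      · exact Set.mem_insert _ _
      · exact Or.inr ⟨⟨⟨c, hc.1⟩, show c < b from lt_of_lt_of_le (b := ⟨α, hα⟩) ha hab⟩, rfl⟩
    refine lt_of_le_of_lt (Cardinal.mk_le_mk_of_subset h2) ?_
    refine lt_of_le_of_lt Cardinal.mk_insert_le ?_
    have hinf' : ℵ₀ ≤ Cardinal.lift.{u+1} o.cof := Cardinal.aleph0_le_lift.2 hinf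
    exact Cardinal.add_lt_of_lt hinf' (lt_of_le_of_lt Cardinal.mk_range_le h1)
      (Cardinal.one_lt_aleph0.trans_le hinf')

theorem sub_HSet {κ θ A : ZFSet.{u}} (hκ : κ.IsTransitive) (h : κ.card < θ.card) (hA : A ⊆ κ) :
    A ∈ HSet θ := HSet_iff.2 ⟨κ, hκ, hA, h⟩

theorem toZFSet_trans (o : Ordinal.{u}) : o.toZFSet.IsTransitive :=
  (ZFSet.isOrdinal_toZFSet o).isTransitive

theorem cof_le_of_cofinal {o : Ordinal.{u}} {x : ZFSet.{u}} (hx : x ⊆ o.toZFSet)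
    (h : ∀ β ∈ o.toZFSet, ∃ γ ∈ x, β ∈ γ ∨ β = γ) : o.cof ≤ x.card := by
  have hc : Order.cof (Set.Iio o) = Cardinal.lift.{u+1} o.cof := by
    rw [Ordinal.cof_Iio, Ordinal.lift_cof]
  rw [← Cardinal.lift_le.{u+1}, ← hc, ← ZFSet.cardinalMk_coe_sort]
  refine (Order.cof_le (s := {a : Set.Iio o | a.1.toZFSet ∈ x}) ?_).trans ?_
  · rintro ⟨a, ha⟩
    obtain ⟨γ, hγ, h1⟩ := h a.toZFSet (Ordinal.toZFSet_mem_toZFSet_iff.2 ha)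
    obtain ⟨b, hb, rfl⟩ := Ordinal.mem_toZFSet_iff.1 (hx hγ)
    refine ⟨⟨b, hb⟩, hγ, ?_⟩
    rcases h1 with h1 | h1
    · exact (Ordinal.toZFSet_mem_toZFSet_iff.1 h1).le
    · exact (Ordinal.toZFSet_injective h1).le
  · refine Cardinal.mk_le_of_injective
      (f := fun a : {a : Set.Iio o | a.1.toZFSet ∈ x} => (⟨a.1.1.toZFSet, a.2⟩ : x)) ?_
    intro a b hab
    exact Subtype.ext (Subtype.ext (Ordinal.toZFSet_injective (congrArg Subtype.val hab)))

theorem WeaklyShrewd.regular {κ : ZFSet.{u}} (h : WeaklyShrewd κ) : ZRegular κ := by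
  refine ⟨h.1, fun x hx hcf => ?_⟩
  obtain ⟨c, hc, rfl⟩ := InfCard_iff.1 h.1
  by_contra hne
  have hlt : x.card < c := by
    refine lt_of_le_of_ne ?_ ?_
    · simpa using ZFSet.card_mono hx
    · intro he; apply hne; simp [mk_toSet, he]
  have hcof : c.ord.cof < c := (cof_le_of_cofinal hx hcf).trans_lt hlt
  have hlim : Order.IsSuccLimit c.ord := Cardinal.isSuccLimit_ord hc
  obtain ⟨A, hAo, hlA, hAl, hAc, hAs⟩ := exists_cof_set hlim (Cardinal.ord_lt_ord.2 hcof)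
  set Z : ZFSet.{u} := ZFSet.sep (fun z => ∃ a ∈ A, a.toZFSet = z) c.ord.toZFSet with hZ
  have hZsub : Z ⊆ c.ord.toZFSet := fun z hz => (ZFSet.mem_sep.1 hz).1
  have memZ : ∀ a ∈ A, a.toZFSet ∈ Z := fun a ha =>
    ZFSet.mem_sep.2 ⟨Ordinal.toZFSet_mem_toZFSet_iff.2 (hAo ha), a, ha, rfl⟩
  have hθ : c.ord.toZFSet ∈ (Order.succ c).ord.toZFSet :=
    Ordinal.toZFSet_mem_toZFSet_iff.2 (Cardinal.ord_lt_ord.2 (Order.lt_succ c))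
  have hθc : c.ord.toZFSet.card < (Order.succ c).ord.toZFSet.card := by simp
  have hZc : c.ord.cof ≤ Z.card := by
    rw [← Cardinal.lift_le.{u+1}, ← ZFSet.cardinalMk_coe_sort]
    refine hAc.trans ?_
    refine Cardinal.mk_le_of_injective (f := fun a : A => (⟨a.1.toZFSet, memZ a a.2⟩ : Z)) ?_
    intro a b hab
    exact Subtype.ext (Ordinal.toZFSet_injective (congrArg Subtype.val hab))
  obtain ⟨κ', θ', hκ', hθ', hκθ, hκκ, hsat⟩ := h.2 .phi1 _ Z SF.fv1 (ZCard_iff.2 ⟨_, rfl⟩) hθ hZsub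
    (by
      rw [sat_phi1 HSet_trans (sub_HSet (toZFSet_trans _) hθc hZsub)]
      refine ⟨c.ord.cof.ord.toZFSet, memZ _ hlA, ?_⟩
      refine exists_injCode (κ := c.ord.toZFSet) ?_ (by simpa using hZc) ?_ hZsub
        (toZFSet_trans _) (by simpa using hc) hθc
      · intro a ha haZ
        obtain ⟨-, b, hb, rfl⟩ := ZFSet.mem_sep.1 haZ
        exact (hAl b hb).not_gt (Ordinal.toZFSet_mem_toZFSet_iff.1 ha)
      · rw [Ordinal.toZFSet_subset_toZFSet_iff]
        exact Cardinal.ord_le_ord.2 hcof.le)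
  obtain ⟨d, rfl⟩ := ZCard_iff.1 hκ'
  obtain ⟨e, rfl⟩ := ZCard_iff.1 hθ'
  have hde : d < e := Cardinal.ord_lt_ord.1 (Ordinal.toZFSet_mem_toZFSet_iff.1 hκθ)
  have hdc : d.ord < c.ord := Ordinal.toZFSet_mem_toZFSet_iff.1 hκκ
  rw [sat_phi1 HSet_trans (sub_HSet (κ := d.ord.toZFSet) (toZFSet_trans _) (by simpa using hde)
    (fun z hz => (ZFSet.mem_inter.1 hz).2))] at hsat
  obtain ⟨l, hl, f, -, hf⟩ := hsat
  obtain ⟨-, a, ha, rfl⟩ := ZFSet.mem_sep.1 (ZFSet.mem_inter.1 hl).1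
  have h1 := hf.card_le
  rw [Ordinal.card_toZFSet] at h1
  have h2 : c.ord.cof ≤ a.card := Cardinal.ord_le.1 (hAl a ha)
  have h3 : (Z ∩ d.ord.toZFSet).card < c.ord.cof := by
    rw [← Cardinal.lift_lt.{_, u+1}, ← ZFSet.cardinalMk_coe_sort]
    refine lt_of_le_of_lt ?_ (hAs _ hdc)
    have : ((Z ∩ d.ord.toZFSet : ZFSet.{u}) : Set ZFSet.{u}) ⊆
        Ordinal.toZFSet '' (A ∩ Set.Iio d.ord) := by
      intro z hz
      obtain ⟨hz1, hz2⟩ := ZFSet.mem_inter.1 hz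
      obtain ⟨-, b, hb, rfl⟩ := ZFSet.mem_sep.1 hz1
      exact ⟨b, ⟨hb, Ordinal.toZFSet_mem_toZFSet_iff.1 hz2⟩, rfl⟩
    exact (Cardinal.mk_le_mk_of_subset this).trans Cardinal.mk_image_le
  exact (h2.trans h1).not_gt h3

theorem WeaklyShrewd.stationary {κ : ZFSet.{u}} (h : WeaklyShrewd κ) :
    ZStationary {β : ZFSet.{u} | ZRegular β} κ := by
  intro C hC
  have hreg := h.regular
  obtain ⟨hCsub, hCu, hCcl⟩ := hC
  obtain ⟨c, hc, rfl⟩ := InfCard_iff.1 h.1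
  set Z : ZFSet.{u} := ZFSet.sep (fun z => z ∈ C) c.ord.toZFSet with hZ
  have hZsub : Z ⊆ c.ord.toZFSet := fun z hz => (ZFSet.mem_sep.1 hz).1
  have hθ : c.ord.toZFSet ∈ (Order.succ c).ord.toZFSet :=
    Ordinal.toZFSet_mem_toZFSet_iff.2 (Cardinal.ord_lt_ord.2 (Order.lt_succ c))
  have hθc : c.ord.toZFSet.card < (Order.succ c).ord.toZFSet.card := by simp
  obtain ⟨κ', θ', hκ', hθ', hκθ, hκκ, hsat⟩ := h.2 .phi2 _ Z SF.fv2 (ZCard_iff.2 ⟨_, rfl⟩) hθ hZsub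
    (by
      rw [sat_phi2 HSet_trans (sub_HSet (toZFSet_trans _) hθc (fun _ h => h))]
      refine ⟨⟨_, h.1.2 ZFSet.omega_zero⟩, ?_, ?_⟩
      · intro x hx
        obtain ⟨γ, hγ, hxγ⟩ := hCu x hx
        exact ⟨γ, ZFSet.mem_sep.2 ⟨hCsub γ hγ, hγ⟩, hCsub γ hγ, hxγ⟩
      · intro x _ hx β hβ f _ hf
        by_contra! hcon
        have h1 := hreg.2 x hx (by
          intro γ hγ
          obtain ⟨a, ha, h2⟩ := hcon γ hγ
          exact ⟨a, ha, or_iff_not_imp_left.2 h2⟩)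
        have h2 := hf.card_le
        obtain ⟨b, hb, rfl⟩ := Ordinal.mem_toZFSet_iff.1 hβ
        simp [mk_toSet] at h1 h2
        rw [h1] at h2
        exact h2.not_gt (Cardinal.lt_ord.1 hb))
  obtain ⟨d, rfl⟩ := ZCard_iff.1 hκ'
  obtain ⟨e, rfl⟩ := ZCard_iff.1 hθ'
  have hde : d < e := Cardinal.ord_lt_ord.1 (Ordinal.toZFSet_mem_toZFSet_iff.1 hκθ)
  have hdec : d.ord.toZFSet.card < e.ord.toZFSet.card := by simpa using hde
  rw [sat_phi2 HSet_trans (sub_HSet (toZFSet_trans _) hdec (fun _ h => h))] at hsat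
  obtain ⟨hne, hunb, hr⟩ := hsat
  refine ⟨_, hCcl _ hκκ hne ?_, ?_⟩
  · intro γ hγ
    obtain ⟨y, hy, hyd, hγy⟩ := hunb γ hγ
    exact ⟨y, (ZFSet.mem_sep.1 (ZFSet.mem_inter.1 hy).1).2, hγy, hyd⟩
  have hlim : Order.IsSuccLimit d.ord := by
    refine ⟨?_, ?_⟩
    · rw [isMin_iff_eq_bot]
      intro h0
      obtain ⟨z, hz⟩ := hne
      rw [h0] at hz
      simp at hz
    · intro a ha
      obtain ⟨y, -, hy, hay⟩ := hunb _ (Ordinal.toZFSet_mem_toZFSet_iff.2 ha.lt)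
      obtain ⟨b, hb, rfl⟩ := Ordinal.mem_toZFSet_iff.1 hy
      exact ha.2 (Ordinal.toZFSet_mem_toZFSet_iff.1 hay) hb
  have hd : ℵ₀ ≤ d := by
    have := Ordinal.omega0_le_of_isSuccLimit hlim
    rwa [← Cardinal.ord_aleph0, Cardinal.ord_le_ord] at this
  refine ⟨InfCard_iff.2 ⟨d, hd, rfl⟩, fun x hx hcf => ?_⟩
  by_contra hne'
  have hlt : x.card < d := by
    refine lt_of_le_of_ne ?_ ?_
    · simpa using ZFSet.card_mono hx
    · intro he; apply hne'; simp [mk_toSet, he]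
  set β := x.card.ord with hβ
  have hβd : β < d.ord := Cardinal.ord_lt_ord.2 hlt
  set x' : ZFSet.{u} := ZFSet.sep (fun z => z ∉ β.toZFSet) x with hx'
  have hxx : x' ⊆ x := fun z hz => (ZFSet.mem_sep.1 hz).1
  have hβm : β.toZFSet ∈ d.ord.toZFSet := Ordinal.toZFSet_mem_toZFSet_iff.2 hβd
  obtain ⟨f, hf, hfi⟩ := exists_injCode (x := x') (y := β.toZFSet) (κ := d.ord.toZFSet)
    (θ := e.ord.toZFSet)
    (fun a ha => (ZFSet.mem_sep.1 ha).2) (by simpa [hβ] using ZFSet.card_mono hxx)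
    (fun z hz => hx (hxx hz)) (toZFSet_trans _ _ hβm) (toZFSet_trans _) (by simpa using hd) hdec
  obtain ⟨γ, hγ, hγx⟩ := hr x' (sub_HSet (toZFSet_trans _) hdec (fun z hz => hx (hxx hz)))
    (fun z hz => hx (hxx hz)) _ hβm f hf hfi
  obtain ⟨g, hg, rfl⟩ := Ordinal.mem_toZFSet_iff.1 hγ
  obtain ⟨z, hz, hmz⟩ := hcf (max g β).toZFSet
    (Ordinal.toZFSet_mem_toZFSet_iff.2 (max_lt hg hβd))
  obtain ⟨b, hb, rfl⟩ := Ordinal.mem_toZFSet_iff.1 (hx hz)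
  rw [Ordinal.toZFSet_mem_toZFSet_iff, Ordinal.toZFSet_injective.eq_iff, ← le_iff_lt_or_eq,
    max_le_iff] at hmz
  obtain ⟨h1, h2⟩ := hγx b.toZFSet (ZFSet.mem_sep.2 ⟨hz, by
    rw [Ordinal.toZFSet_mem_toZFSet_iff]; exact hmz.2.not_gt⟩)
  rw [Ordinal.toZFSet_mem_toZFSet_iff] at h1
  exact h2 (congrArg _ (le_antisymm hmz.1 (not_lt.1 h1)))

/-- If `κ` is a weakly shrewd cardinal, then `κ` is weakly Mahlo: `κ` is
regular and the set of regular cardinals below `κ` is stationary in `κ`. -/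
theorem weaklyShrewd_weaklyMahlo (κ : ZFSet.{u}) (h : WeaklyShrewd κ) :
    ZRegular κ ∧ ZStationary {β : ZFSet.{u} | ZRegular β} κ := by
  exact ⟨h.regular, h.stationary⟩
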